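/- arXiv:2406.16586 — 2 statements merged into one kernel-verified Lean document; each statement's English description precedes it below -/
import Mathlib

section
/- Let p be a prime. Let K₁ and K₂ be separably closed fields of characteristic p, each of which is infinite-dimensional as a vector space over its subfield of p-th powers (i.e., each has infinite degree of imperfection). Let k₁ ⊆ K₁ and k₂ ⊆ K₂ be subfields such that the extension K_i/k_i is separable for i = 1, 2, and let σ : k₁ → k₂ be a ring isomorphism. Then for every formula φ(x₁, …, xₙ) in the first-order language of rings and every tuple (a₁, …, aₙ) from k₁, K₁ ⊨ φ(a₁, …, aₙ) if and only if K₂ ⊨ φ(σ(a₁), …, σ(aₙ)). -/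
open FirstOrder Language

attribute [local instance] FirstOrder.Ring.compatibleRingOfRing

/-- A tuple `v` of elements of `M` is linearly independent over the subfield `S` of `M`. -/
def LinIndepOver {M : Type*} [Field M] (S : Subfield M) {n : ℕ} (v : Fin n → M) : Prop :=
  ∀ c : Fin n → M, (∀ i, c i ∈ S) → ∑ i, c i * v i = 0 → ∀ i, c i = 0

/-- The extension `K / k` is separable: `k` is linearly disjoint from `K ^ p` over `k ^ p`,
i.e. every tuple from `k` which is linearly independent over `k ^ p` remains linearly
independent over `K ^ p`. -/
def IsSepExt (p : ℕ) {K : Type*} [Field K] [ExpChar K p] (k : Subfield K) : Prop :=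
  ∀ (n : ℕ) (v : Fin n → K), (∀ i, v i ∈ k) →
    LinIndepOver (k.map (frobenius K p)) v → LinIndepOver (frobenius K p).fieldRange v

/-- A family that is linearly independent over the subfield of `p`-th powers. -/
def PIndep (p : ℕ) {K : Type*} [Field K] [ExpChar K p] {ι : Type*} (v : ι → K) : Prop :=
  LinearIndependent (frobenius K p).fieldRange v

/-- Separability of a field extension given by a ring homomorphism, in the form of MacLane's
criterion: independence over `p`-th powers is preserved. -/
def SepHom (p : ℕ) {k K : Type*} [Field k] [Field K] [ExpChar k p] [ExpChar K p]
    (f : k →+* K) : Prop :=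
  ∀ (n : ℕ) (v : Fin n → k), PIndep p v → PIndep p (f ∘ v)

/-- `K` is not generated as a field by finitely many elements over `K ^ p` and `T`. -/
def NotFGOver (p : ℕ) {K : Type*} [Field K] [ExpChar K p] (T : Set K) : Prop :=
  ∀ A : Finset K, ∃ x, x ∉ IntermediateField.adjoin (frobenius K p).fieldRange (T ∪ A)

theorem LinearIndependent.of_semilinear_basis {F E V W ι κ : Type*} [Field F] [Field E]
    [AddCommGroup V] [Module F V] [AddCommGroup W] [Module E W] {τ : F →+* E}
    (f : V →ₛₗ[τ] W) (b : Module.Basis ι F V) (hb : LinearIndependent E (f ∘ b))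
    {w : κ → V} (hw : LinearIndependent F w) : LinearIndependent E (f ∘ w) := by
  obtain ⟨g, hg⟩ := LinearMap.exists_leftInverse_of_injective (Finsupp.linearCombination F w)
    (LinearMap.ker_eq_bot.2 hw)
  obtain ⟨r, hr⟩ := LinearMap.exists_leftInverse_of_injective
    (Finsupp.linearCombination E (f ∘ b)) (LinearMap.ker_eq_bot.2 hb)
  let μ : (κ →₀ F) →ₛₗ[τ] (κ →₀ E) :=
    { toFun := Finsupp.mapRange τ (map_zero τ)
      map_add' := fun x y => Finsupp.mapRange_add (map_add τ) x y
      map_smul' := fun c x => by ext i; simp }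
  let G : W →ₗ[E] (κ →₀ E) := (Finsupp.linearCombination E fun i => μ (g (b i))) ∘ₗ r
  have hG : G.comp f = μ.comp g := by
    refine b.ext fun i => ?_
    have h1 : r (f (b i)) = Finsupp.single i 1 := by
      have := LinearMap.congr_fun hr (Finsupp.single i 1)
      simpa using this
    simp [G, h1]
  refine LinearIndependent.of_comp G ?_
  have h2 : ⇑G ∘ (f ∘ w) = fun i => Finsupp.single i (1 : E) := by
    funext i
    have h3 := LinearMap.congr_fun hG (w i)
    have h4 : g (w i) = Finsupp.single i 1 := by
      have := LinearMap.congr_fun hg (Finsupp.single i 1)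
      simpa using this
    simp only [LinearMap.comp_apply, h4] at h3
    simp only [Function.comp_apply, h3]
    ext j
    simp [μ]
  rw [h2]
  exact Finsupp.linearIndependent_single_one E κ

section

variable {p : ℕ} {k K L : Type*} [Field k] [Field K] [Field L] [ExpChar k p] [ExpChar K p]
  [ExpChar L p]

theorem pIndep_iff {ι : Type*} [Fintype ι] {v : ι → K} :
    PIndep p v ↔ ∀ c : ι → K, ∑ i, c i ^ p * v i = 0 → ∀ i, c i = 0 := by
  rw [PIndep, Fintype.linearIndependent_iff]
  have hp : p ≠ 0 := (expChar_pos K p).ne'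
  constructor
  · intro h c hc i
    have := h (fun i => ⟨c i ^ p, c i, rfl⟩) (by simpa [Subfield.smul_def] using hc) i
    simpa [hp, Subtype.ext_iff] using this
  · intro h g hg i
    choose c hc using fun i => (g i).2
    have h1 := h c (by
      rw [← hg]
      refine Finset.sum_congr rfl fun i _ => ?_
      rw [Subfield.smul_def, ← hc i]; rfl) i
    ext
    rw [← hc i, h1]; simp

/-- The map induced by a ring homomorphism between the subfields of `p`-th powers. -/
def powMap (p : ℕ) {k K : Type*} [Field k] [Field K] [ExpChar k p] [ExpChar K p]
    (f : k →+* K) : (frobenius k p).fieldRange →+* (frobenius K p).fieldRange :=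
  f.restrict _ _ (by
    rintro _ ⟨x, rfl⟩
    exact ⟨f x, by simp [frobenius_def]⟩)

/-- A ring homomorphism as a semilinear map over the subfields of `p`-th powers. -/
def powSemilinear (p : ℕ) {k K : Type*} [Field k] [Field K] [ExpChar k p] [ExpChar K p]
    (f : k →+* K) : k →ₛₗ[powMap p f] K :=
  { toFun := f
    map_add' := map_add f
    map_smul' := fun c x => by
      simp only [Subfield.smul_def, smul_eq_mul, map_mul]; rfl }

theorem SepHom.of_basis {f : k →+* K} {ι : Type*}
    (b : Module.Basis ι (frobenius k p).fieldRange k) (hb : PIndep p (f ∘ b)) : SepHom p f :=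
  fun _ _ hv => LinearIndependent.of_semilinear_basis (powSemilinear p f) b hb hv

theorem PIndep.of_comp (f : k →+* K) {ι : Type*} {v : ι → k} (h : PIndep p (f ∘ v)) :
    PIndep p v := by
  rw [PIndep, linearIndependent_iff_finset_linearIndependent] at h ⊢
  intro s
  have := h s
  change PIndep p _ at this
  change PIndep p _
  rw [pIndep_iff] at this ⊢
  intro c hc i
  have h1 := this (fun i => f (c i)) (by
    simpa using congrArg f hc) i
  simpa using h1

theorem SepHom.of_span {f : k →+* K} {ι : Type*} {v : ι → k}
    (hs : ⊤ ≤ Submodule.span (frobenius k p).fieldRange (Set.range v)) (hv : PIndep p (f ∘ v)) :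
    SepHom p f := by
  have hli : LinearIndependent (frobenius k p).fieldRange v := PIndep.of_comp f hv
  refine SepHom.of_basis (Module.Basis.mk hli hs) ?_
  rwa [Module.Basis.coe_mk]

theorem SepHom.pIndep {f : k →+* K} (hf : SepHom p f) {ι : Type*} {v : ι → k} (hv : PIndep p v) :
    PIndep p (f ∘ v) := by
  rw [PIndep, linearIndependent_iff_finset_linearIndependent] at hv ⊢
  intro s
  have h1 := hf _ _ ((linearIndependent_equiv s.equivFin.symm).2 (hv s))
  exact (linearIndependent_equiv s.equivFin.symm).1 h1

theorem SepHom.comp {g : K →+* L} {f : k →+* K} (hg : SepHom p g) (hf : SepHom p f) :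
    SepHom p (g.comp f) := fun n v hv => hg n _ (hf n v hv)

theorem SepHom.of_comp {g : K →+* L} {f : k →+* K} (h : SepHom p (g.comp f)) : SepHom p f :=
  fun n v hv => PIndep.of_comp g (h n v hv)

theorem SepHom.of_range_eq {k' : Type*} [Field k'] [ExpChar k' p] {f : k →+* K} {g : k' →+* K}
    (hf : SepHom p f) (h : Set.range g = Set.range f) : SepHom p g := by
  intro n v hv
  have h1 (x : k') : ∃ y, f y = g x := by
    have : g x ∈ Set.range f := h ▸ ⟨x, rfl⟩
    exact this
  have h2 (y : k) : ∃ x, g x = f y := by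
    have : f y ∈ Set.range g := h ▸ ⟨y, rfl⟩
    exact this
  choose w hw using h1
  choose z hz using h2
  have h3 : PIndep p (w ∘ v) := by
    rw [pIndep_iff] at hv ⊢
    intro c hc i
    have := hv (fun i => z (c i)) (by
      apply g.injective
      have := congrArg f hc
      simpa [hz, hw] using this) i
    have := congrArg g this
    simpa [hz] using this
  have h4 : f ∘ (w ∘ v) = g ∘ v := by funext i; simp [hw]
  exact h4 ▸ hf n _ h3

theorem SepHom.linearIndepOn_pow [Algebra k K] (hf : SepHom p (algebraMap k K)) (s : Finset K)
    (hs : LinearIndepOn k id (s : Set K)) : LinearIndepOn k (· ^ p) (s : Set K) := by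
  let b := Module.Basis.ofVectorSpace (frobenius k p).fieldRange k
  have hb : PIndep p (algebraMap k K ∘ b) := hf.pIndep b.linearIndependent
  classical
  rw [LinearIndepOn, Fintype.linearIndependent_iff] at hs ⊢
  intro g hg
  choose d hd using fun (x : (s : Set K)) i => (b.repr (g x) i).2
  simp only [frobenius_def] at hd
  let T := Finset.univ.biUnion fun x : (s : Set K) => (b.repr (g x)).support
  have h1 (x : (s : Set K)) : g x = ∑ i : T, d x i ^ p * b i := by
    conv_lhs => rw [← b.linearCombination_repr (g x)]
    rw [Finsupp.linearCombination_apply, Finsupp.sum_of_support_subset (s := T) _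
      (Finset.subset_biUnion_of_mem (fun x : (s : Set K) => (b.repr (g x)).support)
        (Finset.mem_univ x)) _ (by simp), ← Finset.sum_coe_sort]
    exact Finset.sum_congr rfl fun i _ => by rw [Subfield.smul_def, ← hd, smul_eq_mul]
  have h2 : PIndep p fun i : T => algebraMap k K (b i) :=
    LinearIndependent.comp hb _ Subtype.val_injective
  rw [pIndep_iff] at h2
  have h3 := h2 (fun i => ∑ x, algebraMap k K (d x i) * x) (by
    rw [← hg]
    simp only [sum_pow_char p, Finset.sum_mul, Algebra.smul_def, mul_pow]
    rw [Finset.sum_comm]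
    refine Finset.sum_congr rfl fun x _ => ?_
    rw [h1 x, map_sum, Finset.sum_mul]
    refine Finset.sum_congr rfl fun i _ => ?_
    rw [map_mul, map_pow]
    ring)
  intro x
  rw [h1]
  refine Finset.sum_eq_zero fun i _ => ?_
  have := hs (fun x => d x i) (by simpa [Algebra.smul_def] using h3 i) x
  rw [this, zero_pow (expChar_pos K p).ne', zero_mul]

theorem SepHom.of_isSeparable [Algebra k L] [Algebra.IsSeparable k L] {f : L →+* K}
    (h : SepHom p (f.comp (algebraMap k L))) : SepHom p f := by
  let b := Module.Basis.ofVectorSpace (frobenius k p).fieldRange k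
  have hb : PIndep p (f ∘ (algebraMap k L ∘ b)) := h.pIndep b.linearIndependent
  refine SepHom.of_span (v := algebraMap k L ∘ b) ?_ hb
  set N := Submodule.span (frobenius L p).fieldRange (Set.range (algebraMap k L ∘ b))
  have h2 (x : k) : algebraMap k L x ∈ N := by
    rw [← b.linearCombination_repr x, Finsupp.linearCombination_apply, Finsupp.sum, map_sum]
    refine sum_mem fun i _ => ?_
    obtain ⟨y, hy⟩ := (b.repr x i).2
    have : algebraMap k L (b.repr x i • b i)
      = (⟨_, algebraMap k L y, rfl⟩ : (frobenius L p).fieldRange) • algebraMap k L (b i) := by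
      simp [Subfield.smul_def, ← hy, frobenius_def]
    rw [this]
    exact N.smul_mem _ (Submodule.subset_span ⟨i, rfl⟩)
  have h3 := Field.span_map_pow_expChar_pow_eq_top_of_isSeparable (F := k) (E := L) p 1
    (v := (id : L → L)) (by simp)
  rintro x -
  have hx : x ∈ (⊤ : Submodule k L) := trivial
  rw [← h3] at hx
  induction hx using Submodule.span_induction with
  | mem x hx =>
    obtain ⟨y, rfl⟩ := hx
    have := N.smul_mem (⟨_, y, rfl⟩ : (frobenius L p).fieldRange) (h2 1)
    simpa [Subfield.smul_def, frobenius_def] using this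
  | zero => exact zero_mem _
  | add x y _ _ hx hy => exact add_mem hx hy
  | smul a x hx' hx =>
    clear hx'
    induction hx using Submodule.span_induction with
    | mem x hx =>
      obtain ⟨i, rfl⟩ := hx
      simpa [Algebra.smul_def] using h2 (a * b i)
    | zero => simp
    | add x y _ _ hx hy => rw [smul_add]; exact add_mem hx hy
    | smul c x _ hx => rw [smul_comm]; exact N.smul_mem c hx

end

section

variable {p : ℕ} {k K : Type*} [Field k] [Field K] [ExpChar k p] [ExpChar K p]

open IntermediateField

theorem SepHom.isSeparable_of_isAlgebraic [Fact p.Prime] [Algebra k K]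
    (h : SepHom p (algebraMap k K)) {x : K} (hx : IsAlgebraic k x) : IsSeparable k x := by
  have h1 : SepHom p (algebraMap k k⟮x⟯) :=
    SepHom.of_comp (g := algebraMap k⟮x⟯ K) (by rwa [← IsScalarTower.algebraMap_eq])
  have : FiniteDimensional k k⟮x⟯ := adjoin.finiteDimensional hx.isIntegral
  obtain ⟨s, hs, hsep⟩ :=
    exists_isTranscendenceBasis_and_isSeparable_of_linearIndepOn_pow_of_essFiniteType p
      (Fact.out : p.Prime) h1.linearIndepOn_pow
  have hs0 : (s : Set k⟮x⟯) = ∅ := by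
    refine Set.eq_empty_of_forall_notMem fun y hy => ?_
    exact hs.1.transcendental ⟨y, hy⟩ (Algebra.IsAlgebraic.isAlgebraic y)
  rw [hs0, adjoin_empty] at hsep
  have : Algebra.IsSeparable k k⟮x⟯ := Algebra.IsSeparable.trans k (⊥ : IntermediateField k k⟮x⟯) _
  have h2 := Algebra.IsSeparable.isSeparable k (AdjoinSimple.gen k x)
  rwa [IsSeparable, minpoly_gen] at h2

theorem SepHom.transcendental [Fact p.Prime] [Algebra k K]
    (h : SepHom p (algebraMap k K)) {x : K}
    (hx : x ∉ adjoin (frobenius K p).fieldRange (Set.range (algebraMap k K))) :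
    Transcendental k x := by
  intro hx'
  have h1 := adjoin_simple_eq_adjoin_pow_expChar_of_isSeparable k K
    (h.isSeparable_of_isAlgebraic hx') p
  apply hx
  have h2 : x ∈ k⟮x ^ p⟯ := h1 ▸ mem_adjoin_simple_self k x
  have h3 : k⟮x ^ p⟯.toSubfield ≤
    (adjoin (frobenius K p).fieldRange (Set.range (algebraMap k K))).toSubfield := by
    rw [adjoin_toSubfield, Subfield.closure_le]
    rintro y (hy | rfl)
    · exact subset_adjoin _ _ hy
    · exact IntermediateField.algebraMap_mem (adjoin (frobenius K p).fieldRange (Set.range (algebraMap k K)))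
        ⟨_, x, rfl⟩
  exact h3 h2

theorem SepHom.adjoin_simple [Fact p.Prime] [Algebra k K]
    (h : SepHom p (algebraMap k K)) {x : K}
    (hx : x ∉ adjoin (frobenius K p).fieldRange (Set.range (algebraMap k K))) :
    SepHom p (algebraMap k⟮x⟯ K) := by
  let b := Module.Basis.ofVectorSpace (frobenius k p).fieldRange k
  have hb : PIndep p (algebraMap k K ∘ b) := h.pIndep b.linearIndependent
  set M := adjoin (frobenius K p).fieldRange (Set.range (algebraMap k K)) with hM
  have hp : p.Prime := Fact.out
  have hxp : x ^ p ∈ M := IntermediateField.algebraMap_mem M (⟨_, x, rfl⟩ : (frobenius K p).fieldRange)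
  have hirr : Irreducible (Polynomial.X ^ p - Polynomial.C (⟨x ^ p, hxp⟩ : M)) := by
    refine X_pow_sub_C_irreducible_of_prime hp fun y hy => hx ?_
    have : (y : K) ^ p = x ^ p := congrArg Subtype.val hy
    have := frobenius_inj K p this
    exact this ▸ y.2
  have hmin : minpoly M x = Polynomial.X ^ p - Polynomial.C (⟨x ^ p, hxp⟩ : M) := by
    symm
    refine minpoly.eq_of_irreducible_of_monic hirr ?_ (Polynomial.monic_X_pow_sub_C _ hp.ne_zero)
    simp [IntermediateField.algebraMap_apply]
  have hdeg : (minpoly M x).natDegree = p := by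
    rw [hmin, Polynomial.natDegree_X_pow_sub_C]
  have hpow : LinearIndependent M fun i : Fin p => x ^ (i : ℕ) := by
    have := linearIndependent_pow (K := M) x
    rwa [hdeg] at this
  let bM : _ → M := fun i => ⟨algebraMap k K (b i), subset_adjoin _ _ ⟨b i, rfl⟩⟩
  have hbM : LinearIndependent (frobenius K p).fieldRange bM :=
    LinearIndependent.of_comp M.val.toLinearMap hb
  have hprod := linearIndependent_smul hbM hpow
  let v : _ × Fin p → k⟮x⟯ := fun q =>
    algebraMap k k⟮x⟯ (b q.1) * AdjoinSimple.gen k x ^ (q.2 : ℕ)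
  refine SepHom.of_span (v := v) ?_ ?_
  · set N := Submodule.span (frobenius k⟮x⟯ p).fieldRange (Set.range v)
    have hNpow (c y : k⟮x⟯) (hy : y ∈ N) : c ^ p * y ∈ N :=
      N.smul_mem (⟨_, c, rfl⟩ : (frobenius k⟮x⟯ p).fieldRange) hy
    have hmono (c : k) (n : ℕ) : algebraMap k k⟮x⟯ c * AdjoinSimple.gen k x ^ n ∈ N := by
      rw [← b.linearCombination_repr c, Finsupp.linearCombination_apply, Finsupp.sum, map_sum,
        Finset.sum_mul]
      refine sum_mem fun i _ => ?_
      obtain ⟨y, hy⟩ := (b.repr c i).2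
      have : algebraMap k k⟮x⟯ (b.repr c i • b i) * AdjoinSimple.gen k x ^ n
        = (algebraMap k k⟮x⟯ y * AdjoinSimple.gen k x ^ (n / p)) ^ p *
          v (i, ⟨n % p, Nat.mod_lt _ hp.pos⟩) := by
        conv_lhs => rw [← Nat.div_add_mod n p]
        simp only [Subfield.smul_def, ← hy, frobenius_def, smul_eq_mul, map_mul, map_pow, v]
        ring
      rw [this]
      exact hNpow _ _ (Submodule.subset_span ⟨_, rfl⟩)
    have hpoly (r : Polynomial k) : Polynomial.aeval (AdjoinSimple.gen k x) r ∈ N := by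
      rw [Polynomial.aeval_eq_sum_range]
      exact sum_mem fun i _ => by simpa [Algebra.smul_def] using hmono (r.coeff i) i
    rintro y -
    obtain ⟨r, s, hrs⟩ := (mem_adjoin_simple_iff k (y : K)).1 y.2
    have hy : y = Polynomial.aeval (AdjoinSimple.gen k x) r /
        Polynomial.aeval (AdjoinSimple.gen k x) s := by
      apply (algebraMap k⟮x⟯ K).injective
      rw [map_div₀, ← Polynomial.aeval_algebraMap_apply, ← Polynomial.aeval_algebraMap_apply]
      exact hrs
    have hy' : y = (Polynomial.aeval (AdjoinSimple.gen k x) s)⁻¹ ^ p *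
        Polynomial.aeval (AdjoinSimple.gen k x) (r * s ^ (p - 1)) := by
      rw [hy, map_mul, map_pow]
      set t := Polynomial.aeval (AdjoinSimple.gen k x) s
      by_cases ht : t = 0
      · simp [ht, hp.ne_zero]
      · obtain ⟨m, rfl⟩ : ∃ m, p = m + 1 := ⟨p - 1, (Nat.succ_pred hp.ne_zero).symm⟩
        rw [Nat.add_sub_cancel, inv_pow, eq_comm, inv_mul_eq_iff_eq_mul₀ (pow_ne_zero _ ht), pow_succ]
        field_simp
    rw [hy']
    exact hNpow _ _ (hpoly _)
  · convert! hprod using 1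

theorem SepHom.exists_algebraicIndependent [Fact p.Prime] [Algebra k K]
    (h : SepHom p (algebraMap k K)) (hK : NotFGOver p (Set.range (algebraMap k K))) (n : ℕ) :
    ∃ T : Finset K, T.card = n ∧ AlgebraicIndepOn k id (T : Set K) ∧
      SepHom p (algebraMap (adjoin k (T : Set K)) K) := by
  classical
  induction n with
  | zero =>
    refine ⟨∅, rfl, ?_, ?_⟩
    · rw [Finset.coe_empty]
      exact algebraicIndependent_empty_type_iff.2 (algebraMap k K).injective
    · refine h.of_range_eq ?_
      change Set.range Subtype.val = _
      rw [Subtype.range_coe, Finset.coe_empty, adjoin_empty, coe_bot]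
  | succ n ih =>
    obtain ⟨T, hc, hT, hs⟩ := ih
    obtain ⟨x, hx⟩ := hK T
    have hx' : x ∉ adjoin (frobenius K p).fieldRange
        (Set.range (algebraMap (adjoin k (T : Set K)) K)) := by
      refine fun h1 => hx ?_
      have h2 : adjoin (frobenius K p).fieldRange
        (Set.range (algebraMap (adjoin k (T : Set K)) K)) ≤
        adjoin (frobenius K p).fieldRange (Set.range (algebraMap k K) ∪ T) := by
        rw [adjoin_le_iff]
        rintro _ ⟨y, rfl⟩
        have h3 : (adjoin k (T : Set K)).toSubfield ≤ (adjoin (frobenius K p).fieldRange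
            (Set.range (algebraMap k K) ∪ T)).toSubfield := by
          rw [adjoin_toSubfield, Subfield.closure_le]
          exact subset_adjoin _ _
        exact h3 y.2
      exact h2 h1
    have htr := hs.transcendental hx'
    have hxT : x ∉ T := fun h => hx (subset_adjoin _ _ (Or.inr h))
    refine ⟨insert x T, by rw [Finset.card_insert_of_notMem hxT, hc], ?_, ?_⟩
    · rw [Finset.coe_insert]
      refine hT.insert ?_
      rw [Set.image_id]
      exact Transcendental.of_tower_top_of_subalgebra_le (algebra_adjoin_le_adjoin k (T : Set K)) htr
    · refine (hs.adjoin_simple hx').of_range_eq ?_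
      have h4 := adjoin_adjoin_left k (T : Set K) {x}
      rw [Set.union_singleton, ← Finset.coe_insert] at h4
      have h5 := congrArg (fun E : IntermediateField k K => (E : Set K)) h4
      change Set.range Subtype.val = Set.range Subtype.val
      rw [Subtype.range_coe, Subtype.range_coe]
      exact h5.symm

theorem SepHom.exists_algHom_adjoin [Fact p.Prime] {K' : Type*} [Field K'] [ExpChar K' p]
    [Algebra k K] [Algebra k K'] [IsSepClosed K'] (h : SepHom p (algebraMap k K))
    (h' : SepHom p (algebraMap k K')) (hK' : NotFGOver p (Set.range (algebraMap k K')))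
    (S : Finset K) : ∃ f : adjoin k (S : Set K) →ₐ[k] K', SepHom p f.toRingHom := by
  set L := adjoin k (S : Set K)
  have hL : SepHom p (algebraMap k L) :=
    SepHom.of_comp (g := algebraMap L K) (by rwa [← IsScalarTower.algebraMap_eq])
  have : Algebra.EssFiniteType k L :=
    essFiniteType_iff.2 (fg_adjoin_finset S)
  obtain ⟨s, hs, hsep⟩ :=
    exists_isTranscendenceBasis_and_isSeparable_of_linearIndepOn_pow_of_essFiniteType p
      (Fact.out : p.Prime) hL.linearIndepOn_pow
  obtain ⟨T, hc, hT, hTs⟩ := h'.exists_algebraicIndependent hK' s.card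
  let e : s ≃ T := Finset.equivOfCardEq hc.symm
  let u : s → K' := fun i => e i
  have hu : AlgebraicIndependent k u := hT.comp e e.injective
  have hur : Set.range u = T := by
    ext y
    constructor
    · rintro ⟨i, rfl⟩; exact (e i).2
    · intro hy; exact ⟨e.symm ⟨y, hy⟩, by simp [u]⟩
  have hsr : Set.range ((↑) : s → L) = s := Subtype.range_coe
  let φ₁ : adjoin k (s : Set L) ≃ₐ[k] adjoin k (T : Set K') :=
    (equivOfEq (by rw [hsr])).trans (hs.1.aevalEquivField.symm.trans
      (hu.aevalEquivField.trans (equivOfEq (by rw [hur]))))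
  let φ : adjoin k (s : Set L) →+* K' :=
    (algebraMap (adjoin k (T : Set K')) K').comp φ₁.toRingEquiv.toRingHom
  let _ : Algebra (adjoin k (s : Set L)) K' := φ.toAlgebra
  have : IsScalarTower k (adjoin k (s : Set L)) K' := by
    refine IsScalarTower.of_algebraMap_eq fun x => ?_
    change _ = algebraMap _ K' (φ₁ (algebraMap _ _ x))
    rw [φ₁.commutes]
    rfl
  have hφ : SepHom p φ := hTs.of_range_eq (φ₁.surjective.range_comp (algebraMap _ K'))
  let f : L →ₐ[adjoin k (s : Set L)] K' := IsSepClosed.lift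
  refine ⟨f.restrictScalars k, SepHom.of_isSeparable (k := adjoin k (s : Set L)) ?_⟩
  convert! hφ using 1
  exact RingHom.ext f.commutes

theorem notFGOver_empty (p : ℕ) {K : Type*} [Field K] [ExpChar K p]
    (h : ¬ FiniteDimensional (frobenius K p).fieldRange K) : NotFGOver p (∅ : Set K) := by
  intro A
  by_contra! hA
  apply h
  rw [Set.empty_union] at hA
  have h1 : FiniteDimensional (frobenius K p).fieldRange
      (adjoin (frobenius K p).fieldRange (A : Set K)) := by
    refine finiteDimensional_adjoin fun x _ => ?_
    refine IsIntegral.of_pow (expChar_pos K p) ?_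
    exact isIntegral_algebraMap (x := (⟨x ^ p, x, rfl⟩ : (frobenius K p).fieldRange))
  have h2 : adjoin (frobenius K p).fieldRange (A : Set K) = ⊤ := by
    ext x; simp [hA x]
  rw [h2] at h1
  exact Module.Finite.equiv (topEquiv (F := (frobenius K p).fieldRange) (E := K)).toLinearEquiv

end

section

variable {I K : Type*} [Field K] (U : Ultrafilter I)

/-- The diagonal embedding of a field in its ultrapower. -/
def germConst (K : Type*) [Field K] : K →+* (U : Filter I).Germ K :=
  (Filter.Germ.coeRingHom (R := K) (U : Filter I)).comp (Pi.constRingHom I K)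

/-- The identification of the ultrapower of a field with the model-theoretic one. -/
def germEquivProduct (K : Type*) [Field K] :
    (U : Filter I).Germ K ≃[Language.ring] (U : Filter I).Product fun _ => K where
  toEquiv := Equiv.refl _
  map_fun' := by
    intro n f x
    obtain ⟨y, rfl⟩ : ∃ y : Fin n → I → K, x = fun i => (y i : (U : Filter I).Germ K) :=
      ⟨fun i => (x i).out, funext fun i => (Quotient.out_eq _).symm⟩
    refine Eq.trans ?_ (Ultraproduct.funMap_cast (M := fun _ => K) (u := U) f y).symm
    cases f <;> rfl
  map_rel' := fun r => isEmptyElim r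

theorem germ_realize {α : Type*} {n : ℕ} (φ : Language.ring.BoundedFormula α n)
    (v : α → K) (xs : Fin n → K) :
    φ.Realize (germConst U K ∘ v) (germConst U K ∘ xs) ↔ φ.Realize v xs := by
  rw [← StrongHomClass.realize_boundedFormula (germEquivProduct U K) φ]
  refine (Ultraproduct.boundedFormula_realize_cast (M := fun _ => K) (u := U) φ
    (fun i _ => v i) (fun i _ => xs i)).trans ?_
  simp

variable (p : ℕ) [ExpChar K p]

instance germ_expChar : ExpChar ((U : Filter I).Germ K) p :=
  expChar_of_injective_ringHom (germConst U K).injective p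

variable {p}

theorem pIndep_germ {ι : Type*} [Fintype ι] (v : ι → I → K)
    (hv : ∀ᶠ s in (U : Filter I), PIndep p fun i => v i s) :
    PIndep p fun i => (v i : (U : Filter I).Germ K) := by
  rw [pIndep_iff]
  intro c hc
  obtain ⟨d, rfl⟩ : ∃ d : ι → I → K, c = fun i => (d i : (U : Filter I).Germ K) :=
      ⟨fun i => (c i).out, funext fun i => (Quotient.out_eq _).symm⟩
  have h1 : ((∑ i, d i ^ p * v i : I → K) : (U : Filter I).Germ K) = (0 : I → K) := by
    change Filter.Germ.coeRingHom (U : Filter I) _ = Filter.Germ.coeRingHom (U : Filter I) _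
    rw [map_sum, map_zero, ← hc]
    rfl
  have h2 := Filter.Germ.coe_eq.1 h1
  intro i
  refine (Filter.Germ.coe_eq (g := (0 : I → K))).2 ?_
  filter_upwards [h2, hv] with s hs hvs
  rw [pIndep_iff] at hvs
  exact hvs (fun i => d i s) (by simpa using hs) i

theorem germConst_sepHom : SepHom p (germConst U K) := fun _ v hv =>
  pIndep_germ U (fun i _ => v i) (Filter.Eventually.of_forall fun _ => hv)

theorem notFGOver_germ (hK : NotFGOver p (∅ : Set K)) (T : Set ((U : Filter I).Germ K))
    (B : I → Finset K)
    (hT : ∀ t ∈ T, ∃ g : I → K, (g : (U : Filter I).Germ K) = t ∧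
      ∀ᶠ s in (U : Filter I), g s ∈ B s) : NotFGOver p T := by
  classical
  intro A
  let r : (U : Filter I).Germ K → I → K := Quotient.out
  have hr (t) : (r t : (U : Filter I).Germ K) = t := Quotient.out_eq _
  choose u hu using fun s => hK (B s ∪ A.image fun a => r a s)
  refine ⟨(u : (U : Filter I).Germ K), fun hmem => ?_⟩
  have key (y) (hmem : y ∈ IntermediateField.adjoin
        (frobenius ((U : Filter I).Germ K) p).fieldRange (T ∪ A)) :
      ∃ g : I → K, (g : (U : Filter I).Germ K) = y ∧ ∀ᶠ s in (U : Filter I), g s ∈ IntermediateField.adjoin (frobenius K p).fieldRange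
        ((∅ : Set K) ∪ (B s ∪ A.image fun a => r a s : Finset K)) := by
    induction hmem using IntermediateField.adjoin_induction with
    | mem x hx =>
      rcases hx with hx | hx
      · obtain ⟨g, hg, h⟩ := hT x hx
        refine ⟨g, hg, h.mono fun s hs => IntermediateField.subset_adjoin _ _ ?_⟩
        simp [hs]
      · refine ⟨r x, hr x, Filter.Eventually.of_forall fun s =>
          IntermediateField.subset_adjoin _ _ ?_⟩
        refine Or.inr ?_
        rw [Finset.coe_union]
        exact Or.inr (Finset.mem_image_of_mem _ hx)
    | algebraMap x =>
      obtain ⟨_, x, rfl⟩ := x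
      refine ⟨r x ^ p, ?_, Filter.Eventually.of_forall fun s =>
        IntermediateField.algebraMap_mem _ (⟨_, r x s, rfl⟩ : (frobenius K p).fieldRange)⟩
      rw [Filter.Germ.coe_pow, hr]; rfl
    | add x y _ _ hx hy =>
      obtain ⟨g, rfl, hg⟩ := hx
      obtain ⟨h, rfl, hh⟩ := hy
      refine ⟨g + h, rfl, ?_⟩
      filter_upwards [hg, hh] with s h1 h2 using add_mem h1 h2
    | inv x _ hx =>
      obtain ⟨g, rfl, hg⟩ := hx
      refine ⟨g⁻¹, rfl, ?_⟩
      filter_upwards [hg] with s h1 using inv_mem h1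
    | mul x y _ _ hx hy =>
      obtain ⟨g, rfl, hg⟩ := hx
      obtain ⟨h, rfl, hh⟩ := hy
      refine ⟨g * h, rfl, ?_⟩
      filter_upwards [hg, hh] with s h1 h2 using mul_mem h1 h2
  obtain ⟨g, hg, hmem⟩ := key _ hmem
  obtain ⟨s, h1, h2⟩ := (hmem.and (Filter.Germ.coe_eq.1 hg)).exists
  exact hu s (h2 ▸ h1)

theorem germ_isSepClosed [IsSepClosed K] : IsSepClosed ((U : Filter I).Germ K) := by
  refine IsSepClosed.of_exists_root _ fun P hmonic hirr hsep => ?_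
  let q := Filter.Germ.coeRingHom (R := K) (U : Filter I)
  have hq : Function.Surjective q := Quotient.mk_surjective
  have hlift (Q : Polynomial ((U : Filter I).Germ K)) : ∃ Q', Polynomial.map q Q' = Q :=
    Polynomial.map_surjective q hq Q
  obtain ⟨P', hP', hdeg, hmonic'⟩ :=
    Polynomial.lifts_and_natDegree_eq_and_monic ((Polynomial.mem_lifts P).2 (hlift P)) hmonic
  obtain ⟨a, b, hab⟩ := hsep
  obtain ⟨a', rfl⟩ := hlift a
  obtain ⟨b', rfl⟩ := hlift b
  let R := a' * P' + b' * Polynomial.derivative P' - 1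
  have hR : R.map q = 0 := by
    simp only [R, Polynomial.map_sub, Polynomial.map_add, Polynomial.map_mul, Polynomial.map_one,
      ← Polynomial.derivative_map, hP', hab, sub_self]
  have hev : ∀ᶠ s in (U : Filter I), R.map (Pi.evalRingHom (fun _ : I => K) s) = 0 := by
    have h1 : ∀ᶠ s in (U : Filter I), ∀ n ∈ R.support, R.coeff n s = 0 := by
      rw [Filter.eventually_all_finset]
      intro n _
      have h2 : ((R.coeff n : I → K) : (U : Filter I).Germ K) = (0 : I → K) := by
        have := congrArg (fun Q => Polynomial.coeff Q n) hR
        change q (R.coeff n) = 0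
        simpa using this
      exact Filter.Germ.coe_eq.1 h2
    filter_upwards [h1] with s hs
    ext n
    by_cases hn : n ∈ R.support
    · simpa using hs n hn
    · simp [Polynomial.notMem_support_iff.1 hn]
  have hroot (s : I) : ∃ x : K, R.map (Pi.evalRingHom (fun _ : I => K) s) = 0 →
      (P'.map (Pi.evalRingHom (fun _ : I => K) s)).eval x = 0 := by
    by_cases h : R.map (Pi.evalRingHom (fun _ : I => K) s) = 0
    · have : Nonempty I := ⟨s⟩
      have hs : (P'.map (Pi.evalRingHom (fun _ : I => K) s)).Separable := by
        refine ⟨a'.map (Pi.evalRingHom (fun _ : I => K) s),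
          b'.map (Pi.evalRingHom (fun _ : I => K) s), ?_⟩
        simpa [R, sub_eq_zero] using h
      obtain ⟨x, hx⟩ := IsSepClosed.exists_root _ (by
        rw [hmonic'.degree_map, Polynomial.degree_eq_natDegree hmonic'.ne_zero, hdeg]
        exact_mod_cast hirr.natDegree_pos.ne') hs
      exact ⟨x, fun _ => hx⟩
    · exact ⟨0, fun h' => absurd h' h⟩
  choose x hx using hroot
  refine ⟨q x, ?_⟩
  rw [← hP', Polynomial.eval_map_apply]
  refine (Filter.Germ.coe_eq (g := (0 : I → K))).2 ?_
  filter_upwards [hev] with s hs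
  exact (Polynomial.eval_map_apply (Pi.evalRingHom (fun _ : I => K) s) x).symm.trans (hx s hs)

end

section

universe w

open IntermediateField

variable {p : ℕ}

theorem exists_elementary_notFGOver {k K : Type w} [Field k] [Field K] [ExpChar k p] [ExpChar K p]
    [IsSepClosed K] (hK : NotFGOver p (∅ : Set K)) (i : k →+* K) (hi : SepHom p i) :
    ∃ (M : Type w) (_ : Field M) (_ : ExpChar M p) (_ : IsSepClosed M) (c : K →+* M),
      NotFGOver p (Set.range (c.comp i)) ∧ NotFGOver p (∅ : Set M) ∧ SepHom p (c.comp i) ∧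
      ∀ (α : Type) (n : ℕ) (φ : Language.ring.BoundedFormula α n) (v : α → K) (xs : Fin n → K),
        φ.Realize (c ∘ v) (c ∘ xs) ↔ φ.Realize v xs := by
  classical
  let U : Ultrafilter (Finset K) := Ultrafilter.of Filter.atTop
  have hU : (U : Filter (Finset K)) ≤ Filter.atTop := Ultrafilter.of_le _
  refine ⟨(U : Filter (Finset K)).Germ K, inferInstance, inferInstance, germ_isSepClosed U,
    germConst U K, ?_, ?_, (germConst_sepHom U).comp hi, fun _ _ φ v xs => germ_realize U φ v xs⟩
  · refine notFGOver_germ U hK _ id ?_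
    rintro _ ⟨x, rfl⟩
    refine ⟨fun _ => i x, rfl, hU ?_⟩
    filter_upwards [Filter.eventually_ge_atTop {i x}] with s hs
    exact hs (Finset.mem_singleton_self _)
  · exact notFGOver_germ U hK _ id fun _ h => h.elim

variable [Fact p.Prime]

theorem exists_sepHom_germ {k K L : Type w} [Field k] [Field K] [Field L] [ExpChar k p]
    [ExpChar K p] [ExpChar L p] [IsSepClosed L] (i : k →+* K) (j : k →+* L) (hi : SepHom p i)
    (hj : SepHom p j) (hL : NotFGOver p (Set.range j)) (U : Ultrafilter (Finset K))
    (hU : (U : Filter (Finset K)) ≤ Filter.atTop) :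
    ∃ f : K →+* (U : Filter (Finset K)).Germ L, f.comp i = (germConst U L).comp j ∧
      SepHom p f := by
  classical
  let _ : Algebra k K := i.toAlgebra
  let _ : Algebra k L := j.toAlgebra
  have hex (S : Finset K) := SepHom.exists_algHom_adjoin (K' := L) hi hj hL S
  choose F hF using hex
  let G (x : K) (S : Finset K) : L := if h : x ∈ adjoin k (S : Set K) then F S ⟨x, h⟩ else 0
  have hG {x : K} {S : Finset K} (h : x ∈ adjoin k (S : Set K)) : G x S = F S ⟨x, h⟩ := dif_pos h
  have hmem (x : K) : ∀ᶠ S : Finset K in (U : Filter (Finset K)),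
      x ∈ adjoin k ((S : Finset K) : Set K) := by
    refine hU ?_
    filter_upwards [Filter.eventually_ge_atTop {x}] with S hS
    exact subset_adjoin _ _ (hS (Finset.mem_singleton_self _))
  let f : K →+* (U : Filter (Finset K)).Germ L :=
    { toFun := fun x => (G x : (U : Filter (Finset K)).Germ L)
      map_one' := by
        refine (Filter.Germ.coe_eq (g := (1 : Finset K → L))).2 (.of_forall fun S => ?_)
        rw [hG (one_mem _)]
        exact map_one (F S)
      map_zero' := by
        refine (Filter.Germ.coe_eq (g := (0 : Finset K → L))).2 (.of_forall fun S => ?_)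
        rw [hG (zero_mem _)]
        exact map_zero (F S)
      map_mul' := fun x y => by
        refine (Filter.Germ.coe_eq (g := G x * G y)).2 ?_
        filter_upwards [hmem x, hmem y] with S hx hy
        rw [Pi.mul_apply, hG hx, hG hy, hG (mul_mem hx hy), ← map_mul]
        rfl
      map_add' := fun x y => by
        refine (Filter.Germ.coe_eq (g := G x + G y)).2 ?_
        filter_upwards [hmem x, hmem y] with S hx hy
        rw [Pi.add_apply, hG hx, hG hy, hG (add_mem hx hy), ← map_add]
        rfl }
  refine ⟨f, ?_, ?_⟩
  · ext x
    refine (Filter.Germ.coe_eq (g := fun _ => j x)).2 (.of_forall fun S => ?_)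
    change G (i x) S = j x
    refine (hG ((adjoin k (S : Set K)).algebraMap_mem x)).trans ?_
    exact (F S).commutes x
  · intro n v hv
    refine pIndep_germ U (fun a => G (v a)) ?_
    filter_upwards [Filter.eventually_all.2 fun a => hmem (v a)] with S hS
    have h1 : PIndep p fun a => (⟨v a, hS a⟩ : adjoin k (S : Set K)) :=
      PIndep.of_comp (adjoin k (S : Set K)).val.toRingHom hv
    have h2 := hF S _ _ h1
    convert h2 using 1
    funext a
    exact hG (hS a)

theorem exists_amalgam {k K₁ K₂ : Type w} [Field k] [Field K₁] [Field K₂] [ExpChar k p]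
    [ExpChar K₁ p] [ExpChar K₂ p] [IsSepClosed K₂] (hK₂ : NotFGOver p (∅ : Set K₂))
    (i₁ : k →+* K₁) (i₂ : k →+* K₂) (h₁ : SepHom p i₁) (h₂ : SepHom p i₂) :
    ∃ (M : Type w) (_ : Field M) (_ : ExpChar M p) (_ : IsSepClosed M) (f : K₁ →+* M)
      (c : K₂ →+* M), f.comp i₁ = c.comp i₂ ∧ SepHom p f ∧ NotFGOver p (∅ : Set M) ∧
      ∀ (α : Type) (n : ℕ) (φ : Language.ring.BoundedFormula α n) (v : α → K₂) (xs : Fin n → K₂),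
        φ.Realize (c ∘ v) (c ∘ xs) ↔ φ.Realize v xs := by
  classical
  obtain ⟨L, _, _, _, c, hc, hL, hci, hφ⟩ := exists_elementary_notFGOver hK₂ i₂ h₂
  let U : Ultrafilter (Finset K₁) := Ultrafilter.of Filter.atTop
  obtain ⟨f, hf, hsep⟩ := exists_sepHom_germ i₁ (c.comp i₂) h₁ hci hc U (Ultrafilter.of_le _)
  exact ⟨(U : Filter (Finset K₁)).Germ L, inferInstance, inferInstance, germ_isSepClosed U,
    f, (germConst U L).comp c, hf, hsep, notFGOver_germ U hL _ (fun _ => ∅) fun _ h => h.elim,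
    fun _ _ φ v xs => (germ_realize U φ (c ∘ v) (c ∘ xs)).trans (hφ _ _ φ v xs)⟩

theorem realize_term_ringHom {R S : Type*} [CommRing R] [CommRing S] (f : R →+* S) {α : Type*}
    (t : Language.ring.Term α) (v : α → R) : t.realize (f ∘ v) = f (t.realize v) := by
  induction t with
  | var => rfl
  | func g ts ih =>
    cases g with
    | add => exact (congrArg₂ (· + ·) (ih 0) (ih 1)).trans (map_add f _ _).symm
    | mul => exact (congrArg₂ (· * ·) (ih 0) (ih 1)).trans (map_mul f _ _).symm
    | neg => exact (congrArg (- ·) (ih 0)).trans (map_neg f _).symm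
    | zero => exact (map_zero f).symm
    | one => exact (map_one f).symm

theorem realize_iff_of_sepHom {α : Type} {n : ℕ} (φ : Language.ring.BoundedFormula α n) :
    ∀ {k K₁ K₂ : Type w} [Field k] [Field K₁] [Field K₂] [ExpChar k p] [ExpChar K₁ p]
      [ExpChar K₂ p] [IsSepClosed K₁] [IsSepClosed K₂] (_ : NotFGOver p (∅ : Set K₁))
      (_ : NotFGOver p (∅ : Set K₂)) (i₁ : k →+* K₁) (i₂ : k →+* K₂) (_ : SepHom p i₁)
      (_ : SepHom p i₂) (v : α → k) (xs : Fin n → k),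
      φ.Realize (i₁ ∘ v) (i₁ ∘ xs) ↔ φ.Realize (i₂ ∘ v) (i₂ ∘ xs) := by
  induction φ with
  | falsum => intros; rfl
  | equal t₁ t₂ =>
    intro k K₁ K₂ _ _ _ _ _ _ _ _ _ _ i₁ i₂ _ _ v xs
    simp only [BoundedFormula.Realize, ← Sum.comp_elim, realize_term_ringHom,
      i₁.injective.eq_iff, i₂.injective.eq_iff]
  | rel R _ => exact isEmptyElim R
  | imp φ ψ hφ hψ =>
    intro k K₁ K₂ _ _ _ _ _ _ _ _ h₁ h₂ i₁ i₂ s₁ s₂ v xs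
    rw [BoundedFormula.realize_imp, BoundedFormula.realize_imp, hφ h₁ h₂ i₁ i₂ s₁ s₂,
      hψ h₁ h₂ i₁ i₂ s₁ s₂]
  | @all n ψ ih =>
    have key : ∀ {k K₁ K₂ : Type w} [Field k] [Field K₁] [Field K₂] [ExpChar k p] [ExpChar K₁ p]
      [ExpChar K₂ p] [IsSepClosed K₁] [IsSepClosed K₂] (_ : NotFGOver p (∅ : Set K₁))
      (_ : NotFGOver p (∅ : Set K₂)) (i₁ : k →+* K₁) (i₂ : k →+* K₂) (_ : SepHom p i₁)
      (_ : SepHom p i₂) (v : α → k) (xs : Fin n → k),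
      ψ.all.Realize (i₂ ∘ v) (i₂ ∘ xs) → ψ.all.Realize (i₁ ∘ v) (i₁ ∘ xs) := by
      intro k K₁ K₂ _ _ _ _ _ _ _ _ h₁ h₂ i₁ i₂ s₁ s₂ v xs h
      obtain ⟨M, _, _, _, f, c, hfc, hf, hM, hφ⟩ := exists_amalgam h₂ i₁ i₂ s₁ s₂
      rw [← hφ] at h
      rw [BoundedFormula.realize_all] at h ⊢
      intro b
      have e (x : k) : c (i₂ x) = f (i₁ x) := (RingHom.congr_fun hfc x).symm
      have := (ih h₁ hM (RingHom.id K₁) f (fun _ _ h => h) hf (i₁ ∘ v)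
        (Fin.snoc (i₁ ∘ xs) b)).2
      rw [Fin.comp_snoc] at this
      refine this ?_
      convert h (f b) using 1
      · funext a; exact (e _).symm
      · congr 1; funext a; exact (e _).symm
    intro k K₁ K₂ _ _ _ _ _ _ _ _ h₁ h₂ i₁ i₂ s₁ s₂ v xs
    exact ⟨key h₂ h₁ i₂ i₁ s₂ s₁ v xs, key h₁ h₂ i₁ i₂ s₁ s₂ v xs⟩

end

section

universe u v

variable {p : ℕ}

theorem IsSepClosed.of_ringEquiv {K L : Type*} [Field K] [Field L] [IsSepClosed K] (e : K ≃+* L) :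
    IsSepClosed L := by
  refine IsSepClosed.of_exists_root _ fun P _ hirr hsep => ?_
  obtain ⟨x, hx⟩ := IsSepClosed.exists_eval₂_eq_zero (e.symm : L →+* K) P hirr.degree_pos.ne' hsep
  refine ⟨e x, ?_⟩
  have := congrArg (e : K →+* L) hx
  rw [Polynomial.hom_eval₂, map_zero] at this
  simpa [Polynomial.eval₂_eq_eval_map] using this

theorem SepHom.ringEquiv {K L : Type*} [Field K] [Field L] [ExpChar K p] [ExpChar L p]
    (e : K ≃+* L) : SepHom p (e : K →+* L) :=
  SepHom.of_range_eq (f := RingHom.id L) (fun _ _ h => h) (by simp [e.surjective.range_eq])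

theorem NotFGOver.of_ringEquiv {K L : Type*} [Field K] [Field L] [ExpChar K p] [ExpChar L p]
    (e : K ≃+* L) (h : NotFGOver p (∅ : Set K)) : NotFGOver p (∅ : Set L) := by
  classical
  intro A
  obtain ⟨x, hx⟩ := h (A.image e.symm)
  have key (y : L) (hy : y ∈ IntermediateField.adjoin (frobenius L p).fieldRange
      ((∅ : Set L) ∪ A)) : e.symm y ∈ IntermediateField.adjoin (frobenius K p).fieldRange
      ((∅ : Set K) ∪ (A.image e.symm : Finset K)) := by
    induction hy using IntermediateField.adjoin_induction with
    | mem y hy =>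
      refine IntermediateField.subset_adjoin _ _ (Or.inr ?_)
      exact Finset.mem_image_of_mem _ (by simpa using hy)
    | algebraMap y =>
      obtain ⟨_, y, rfl⟩ := y
      have := IntermediateField.algebraMap_mem (IntermediateField.adjoin
        (frobenius K p).fieldRange ((∅ : Set K) ∪ (A.image e.symm : Finset K)))
        (⟨_, e.symm y, rfl⟩ : (frobenius K p).fieldRange)
      convert this
      exact map_pow e.symm y p
    | add y z _ _ hy hz => exact map_add e.symm y z ▸ add_mem hy hz
    | inv y _ hy => exact map_inv₀ e.symm y ▸ inv_mem hy
    | mul y z _ _ hy hz => exact map_mul e.symm y z ▸ mul_mem hy hz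
  exact ⟨e x, fun hmem => hx (by simpa using key _ hmem)⟩

theorem IsSepExt.sepHom_subtype {K : Type*} [Field K] [ExpChar K p] (k : Subfield K)
    [ExpChar k p] (h : IsSepExt p k) : SepHom p k.subtype := by
  have hp : p ≠ 0 := (expChar_pos K p).ne'
  intro n v hv
  rw [pIndep_iff] at hv ⊢
  have h1 : LinIndepOver (k.map (frobenius K p)) fun i => (v i : K) := by
    intro c hc hsum i
    choose d hd hdc using hc
    have h2 := hv (fun i => ⟨d i, hd i⟩) (by
      apply Subtype.ext
      rw [ZeroMemClass.coe_zero, ← hsum, AddSubmonoidClass.coe_finsetSum]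
      exact Finset.sum_congr rfl fun i _ => by rw [← hdc i]; rfl) i
    rw [← hdc i, show d i = 0 from congrArg Subtype.val h2, map_zero]
  intro c hc i
  have := h n _ (fun i => (v i).2) h1 (fun i => c i ^ p) (fun i => ⟨c i, rfl⟩) hc i
  exact (pow_eq_zero_iff hp).1 this

theorem realize_formula_ringEquiv {K L : Type*} [Field K] [Field L] (e : K ≃+* L) {α : Type*}
    (φ : Language.ring.Formula α) (v : α → K) : φ.Realize (e ∘ v) ↔ φ.Realize v :=
  StrongHomClass.realize_formula (FirstOrder.Ring.languageEquivEquivRingEquiv.symm e) φ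

end

/-- Ershov–Srour description of types in `SCF_p^∞`: if `K₁`, `K₂` are separably closed fields
of characteristic `p` and infinite degree of imperfection, `k₁ ⊆ K₁`, `k₂ ⊆ K₂` are subfields
with `K_i / k_i` separable, and `σ : k₁ ≃ k₂` is a ring isomorphism, then corresponding tuples
from `k₁` and `k₂` satisfy the same ring-language formulas in `K₁` resp. `K₂`. -/
theorem scf_infinite_imperfection_same_type
    (p : ℕ) [Fact p.Prime]
    (K₁ : Type*) (K₂ : Type*) [Field K₁] [Field K₂] [CharP K₁ p] [CharP K₂ p]
    [IsSepClosed K₁] [IsSepClosed K₂]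
    (h₁ : ¬ FiniteDimensional ((frobenius K₁ p).fieldRange) K₁)
    (h₂ : ¬ FiniteDimensional ((frobenius K₂ p).fieldRange) K₂)
    (k₁ : Subfield K₁) (k₂ : Subfield K₂)
    (hs₁ : IsSepExt p k₁) (hs₂ : IsSepExt p k₂)
    (σ : k₁ ≃+* k₂) :
    ∀ (n : ℕ) (φ : Language.ring.Formula (Fin n)) (a : Fin n → k₁),
      φ.Realize (fun i => (a i : K₁)) ↔ φ.Realize (fun i => (σ (a i) : K₂)) := by
  intro n φ a
  let e₁ : K₁ ≃+* ULift.{u_2} K₁ := ULift.ringEquiv.symm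
  let e₂ : K₂ ≃+* ULift.{u_1} K₂ := ULift.ringEquiv.symm
  let e : ULift.{u_2} k₁ ≃+* k₁ := ULift.ringEquiv
  have : CharP k₁ p := (RingHom.charP_iff k₁.subtype k₁.subtype.injective p).2 inferInstance
  have : CharP k₂ p := (RingHom.charP_iff k₂.subtype k₂.subtype.injective p).2 inferInstance
  have := expChar_of_injective_ringHom e₁.toRingHom.injective p
  have := expChar_of_injective_ringHom e₂.toRingHom.injective p
  have := expChar_of_injective_ringHom e.symm.toRingHom.injective p
  have := IsSepClosed.of_ringEquiv e₁
  have := IsSepClosed.of_ringEquiv e₂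
  have main := realize_iff_of_sepHom φ ((notFGOver_empty p h₁).of_ringEquiv e₁)
    ((notFGOver_empty p h₂).of_ringEquiv e₂)
    (e₁.toRingHom.comp (k₁.subtype.comp e.toRingHom))
    (e₂.toRingHom.comp (k₂.subtype.comp (σ.toRingHom.comp e.toRingHom)))
    ((SepHom.ringEquiv e₁).comp ((hs₁.sepHom_subtype).comp (SepHom.ringEquiv e)))
    ((SepHom.ringEquiv e₂).comp ((hs₂.sepHom_subtype).comp
      ((SepHom.ringEquiv σ).comp (SepHom.ringEquiv e))))
    (e.symm ∘ a) default
  rw [← realize_formula_ringEquiv e₁, ← realize_formula_ringEquiv e₂]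
  rw [Formula.Realize, Formula.Realize]
  convert main using 2
  all_goals
    funext i
    rfl
end

section
/- Let p be a prime and let e be a natural number. Any two separably closed fields K₁, K₂ of characteristic p with [K₁ : K₁^p] = [K₂ : K₂^p] = p^e (i.e., of the same finite degree of imperfection e) are elementarily equivalent in the first-order language of rings. -/
open FirstOrder Language

attribute [local instance] FirstOrder.Ring.compatibleRingOfRing

universe w

/-- A finite family `v` is a Frobenius basis of a field `K` with respect to `p` if every element of
`K` is uniquely a linear combination of `v` whose coefficients are `p`-th powers `y i ^ p`. -/
def IsFrobeniusBasis (p : ℕ) {ι K : Type*} [Fintype ι] [Field K] (v : ι → K) : Prop :=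
  ∀ x : K, ∃! y : ι → K, ∑ i, y i ^ p * v i = x

namespace Filter.Germ

variable {I K : Type*} (u : Ultrafilter I) [Field K]

/-- The diagonal embedding of a field into its ultrapower. -/
noncomputable def diagonal : K →+* Germ (u : Filter I) K :=
  (coeRingHom (u : Filter I)).comp (Pi.constRingHom I K)

lemma coeRingHom_surjective :
    Function.Surjective (coeRingHom (u : Filter I) : (I → K) →+* Germ (u : Filter I) K) :=
  fun x ↦ inductionOn x fun f ↦ ⟨f, rfl⟩

lemma coeRingHom_eq_iff {f g : I → K} :
    coeRingHom (u : Filter I) f = coeRingHom (u : Filter I) g ↔ ∀ᶠ i in u, f i = g i :=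
  coe_eq

lemma isFrobeniusBasis_diagonal {p : ℕ} {ι : Type*} [Fintype ι] {v : ι → K}
    (hv : IsFrobeniusBasis p v) : IsFrobeniusBasis p (diagonal u ∘ v) := by
  have key (y : ι → I → K) : ∑ i, coeRingHom (u : Filter I) (y i) ^ p * (diagonal u ∘ v) i =
      coeRingHom (u : Filter I) (fun j ↦ ∑ i, y i j ^ p * v i) := by
    have : (fun j ↦ ∑ i, y i j ^ p * v i) = ∑ i, y i ^ p * Pi.constRingHom I K (v i) := by
      ext j; simp
    simp [this, diagonal]
  intro x
  obtain ⟨x, rfl⟩ := coeRingHom_surjective u x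
  choose y hy hy' using fun j ↦ hv (x j)
  refine ⟨fun i ↦ coeRingHom (u : Filter I) fun j ↦ y j i, ?_, fun z hz ↦ ?_⟩
  · exact (key _).trans (congrArg _ (funext hy))
  · choose z' hz' using fun i ↦ coeRingHom_surjective u (z i)
    obtain rfl : (fun i ↦ coeRingHom (u : Filter I) (z' i)) = z := funext hz'
    have := (coeRingHom_eq_iff u).1 ((key z').symm.trans hz)
    ext i
    refine (coeRingHom_eq_iff u).2 (this.mono fun j hj ↦ ?_)
    exact congrFun (hy' j (fun i ↦ z' i j) hj) i

instance [IsSepClosed K] : IsSepClosed (Germ (u : Filter I) K) := by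
  open Polynomial in
  refine IsSepClosed.of_exists_root _ fun P hm hirr ⟨a, b, hab⟩ ↦ ?_
  have hsurj := Polynomial.map_surjective _ (coeRingHom_surjective (K := K) u)
  obtain ⟨Q, hQ, hQd, hQm⟩ := Polynomial.lifts_and_natDegree_eq_and_monic
    (f := coeRingHom (u : Filter I)) (p := P) (by
      rw [Polynomial.mem_lifts]; exact hsurj P) hm
  obtain ⟨a, rfl⟩ := hsurj a
  obtain ⟨b, rfl⟩ := hsurj b
  have h0 : ∀ᶠ i in u, (a * Q + b * derivative Q).map (Pi.evalRingHom _ i) = 1 := by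
    set R := a * Q + b * derivative Q - 1 with hR
    have hR0 : R.map (coeRingHom (u : Filter I)) = 0 := by
      rw [hR]
      simp only [Polynomial.map_sub, Polynomial.map_add, Polynomial.map_mul,
        ← Polynomial.derivative_map, hQ, hab, Polynomial.map_one, sub_self]
    have : ∀ᶠ i in u, ∀ n ∈ R.support, R.coeff n i = 0 := by
      rw [Filter.eventually_all_finset]
      intro n _
      have := congrArg (fun P ↦ P.coeff n) hR0
      simp only [coeff_map, coeff_zero] at this
      exact (coeRingHom_eq_iff (g := 0) u).1 (by simpa using this)
    refine this.mono fun i hi ↦ ?_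
    have hz : R.map (Pi.evalRingHom _ i) = 0 := by
      ext n
      simp only [coeff_map, coeff_zero, Pi.evalRingHom_apply]
      by_cases hn : n ∈ R.support
      · exact hi n hn
      · rw [notMem_support_iff.1 hn]; rfl
    rw [hR, Polynomial.map_sub, Polynomial.map_one] at hz
    exact sub_eq_zero.1 hz
  have hroot : ∀ᶠ i in u, ∃ x : K, (Q.map (Pi.evalRingHom _ i)).eval x = 0 := by
    refine h0.mono fun i hi ↦ IsSepClosed.exists_root _ ?_ ⟨a.map (Pi.evalRingHom _ i),
      b.map (Pi.evalRingHom _ i), ?_⟩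
    · rw [hQm.degree_map]
      have := degree_pos_of_irreducible hirr
      rw [← hQ, hQm.degree_map] at this
      exact this.ne'
    · rw [← hi, derivative_map]; simp
  classical
  obtain ⟨x, hx⟩ : ∃ x : I → K, ∀ᶠ i in u, (Q.map (Pi.evalRingHom _ i)).eval (x i) = 0 := by
    refine ⟨fun i ↦ if h : ∃ x : K, (Q.map (Pi.evalRingHom _ i)).eval x = 0 then h.choose else 0,
      hroot.mono fun i hi ↦ ?_⟩
    simp only [dif_pos hi]
    exact hi.choose_spec
  refine ⟨coeRingHom (u : Filter I) x, ?_⟩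
  rw [← hQ, eval_map, eval₂_at_apply, ← map_zero (coeRingHom (u : Filter I)), coeRingHom_eq_iff]
  refine hx.mono fun i hi ↦ ?_
  rw [eval_map] at hi
  exact (eval₂_at_apply (Pi.evalRingHom (fun _ ↦ K) i) x).symm.trans hi

/-- The ultrapower as a first-order structure is the ultrapower as a ring. -/
noncomputable def productEquiv :
    Language.ring.Equiv ((u : Filter I).Product fun _ ↦ K) (Germ (u : Filter I) K) where
  toEquiv := Equiv.refl _
  map_fun' {n} f x := by
    obtain ⟨y, rfl⟩ : ∃ y : Fin n → I → K,
        (fun i ↦ (y i : (u : Filter I).Product fun _ ↦ K)) = x :=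
      ⟨fun i ↦ (x i).out, funext fun i ↦ Quotient.out_eq' _⟩
    refine (Ultraproduct.funMap_cast f y).trans ?_
    cases f <;> rfl
  map_rel' r := r.elim

/-- The diagonal embedding into an ultrapower is elementary. -/
lemma realize_diagonal {n : ℕ} (φ : Language.ring.BoundedFormula Empty n) (x : Fin n → K) :
    φ.Realize default (diagonal u ∘ x) ↔ φ.Realize default x := by
  rw [← StrongHomClass.realize_boundedFormula (productEquiv u).symm]
  have := Ultraproduct.boundedFormula_realize_cast (u := u) (M := fun _ ↦ K) φ default
    (fun i _ ↦ x i)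
  rw [← Filter.eventually_const (f := (u : Filter I)) (p := φ.Realize default x)]
  refine Iff.trans (iff_of_eq ?_) (this.trans (iff_of_eq ?_))
  · congr 1
    exact Subsingleton.elim _ _
  · simp only [Subsingleton.elim (fun i : Empty ↦ (default : Empty → I → K) i _) default]

open MvPolynomial in
/-- Some ultrapower of an infinite field `K` contains a family on which no nonzero polynomial over `K`
vanishes. -/
lemma exists_forall_ne_zero_eval₂_ne_zero (K : Type*) [Field K] [Infinite K] (σ : Type*) :
    ∃ (u : Ultrafilter (Finset (MvPolynomial σ K)))
      (x : σ → Germ (u : Filter (Finset (MvPolynomial σ K))) K),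
      ∀ P : MvPolynomial σ K, P ≠ 0 → P.eval₂ (diagonal u) x ≠ 0 := by
  classical
  have h (S : Finset (MvPolynomial σ K)) :
      ∃ x : σ → K, ∀ P ∈ S, P ≠ 0 → eval x P ≠ 0 := by
    have hne : ∏ P ∈ S with P ≠ 0, P ≠ 0 := Finset.prod_ne_zero_iff.2 fun P hP ↦
      (Finset.mem_filter.1 hP).2
    obtain ⟨x, hx⟩ : ∃ x, eval x (∏ P ∈ S with P ≠ 0, P) ≠ 0 := by
      by_contra! hx
      exact hne (MvPolynomial.funext fun x ↦ by rw [hx, map_zero])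
    rw [map_prod, Finset.prod_ne_zero_iff] at hx
    exact ⟨x, fun P hP h0 ↦ hx P (Finset.mem_filter.2 ⟨hP, h0⟩)⟩
  choose x hx using h
  refine ⟨Ultrafilter.of Filter.atTop, fun i ↦ coeRingHom _ fun S ↦ x S i, fun P hP h0 ↦ ?_⟩
  set u := Ultrafilter.of (Filter.atTop : Filter (Finset (MvPolynomial σ K)))
  have heval : P.eval₂ (diagonal u)
      (fun i ↦ coeRingHom (u : Filter (Finset (MvPolynomial σ K))) fun S ↦ x S i) =
      coeRingHom (u : Filter (Finset (MvPolynomial σ K))) fun S ↦ eval (x S) P := by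
    have : (fun S ↦ eval (x S) P) =
        P.eval₂ (Pi.constRingHom _ K) (fun i S ↦ x S i) := by
      ext S
      have := MvPolynomial.hom_eval₂ P (Pi.constRingHom _ K) (Pi.evalRingHom _ S)
        (fun i S ↦ x S i)
      exact this.symm
    rw [this, hom_eval₂]
    rfl
  rw [heval, ← map_zero (coeRingHom (u : Filter (Finset (MvPolynomial σ K)))),
    coeRingHom_eq_iff] at h0
  have h1 : ∀ᶠ S in (u : Filter (Finset (MvPolynomial σ K))), {P} ≤ S :=
    (Filter.eventually_ge_atTop {P}).filter_mono (Ultrafilter.of_le _)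
  obtain ⟨S, hS, hS'⟩ := (h0.and h1).exists
  exact hx S P (Finset.singleton_subset_iff.1 hS') hP hS

/-- A field embeds into an ultrapower of `K` over a base field `A` as soon as each of its finitely
generated subextensions embeds into `K`. -/
lemma exists_ringHom_of_forall_adjoin (A F : Type*) [Field A] [Field F] [Algebra A F] [Algebra A K]
    (h : ∀ S : Finset F, Nonempty (IntermediateField.adjoin A (S : Set F) →ₐ[A] K)) :
    ∃ (u : Ultrafilter (Finset F)) (g : F →+* Germ (u : Filter (Finset F)) K),
      g.comp (algebraMap A F) = (diagonal u).comp (algebraMap A K) := by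
  classical
  let ρ (S : Finset F) := (h S).some
  let r (x : F) (S : Finset F) : K :=
    if hx : x ∈ IntermediateField.adjoin A (S : Set F) then ρ S ⟨x, hx⟩ else 0
  let u := Ultrafilter.of (Filter.atTop : Filter (Finset F))
  have hmem (x : F) : ∀ᶠ S in u, x ∈ IntermediateField.adjoin A ((S : Finset F) : Set F) :=
    ((Filter.eventually_ge_atTop ({x} : Finset F)).filter_mono (Ultrafilter.of_le _)).mono fun S hS ↦
      IntermediateField.subset_adjoin _ _ (Finset.singleton_subset_iff.1 hS)
  have halg (a : A) (S) : r (algebraMap A F a) S = algebraMap A K a := by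
    have : algebraMap A F a ∈ IntermediateField.adjoin A (S : Set F) :=
      IntermediateField.algebraMap_mem _ a
    simp only [r, dif_pos this]
    exact (ρ S).commutes a
  refine ⟨u, ⟨⟨⟨fun x ↦ coeRingHom (u : Filter (Finset F)) (r x), ?_⟩, fun x y ↦ ?_⟩, ?_,
    fun x y ↦ ?_⟩, ?_⟩
  · rw [← map_one (coeRingHom (u : Filter (Finset F))), ← map_one (algebraMap A F)]
    congr 1; ext S; rw [halg, map_one]; rfl
  · rw [← map_mul, coeRingHom_eq_iff]
    filter_upwards [hmem x, hmem y] with S hx hy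
    simp only [r, Pi.mul_apply, dif_pos hx, dif_pos hy, dif_pos (mul_mem hx hy), ← map_mul]
    rfl
  · dsimp only
    rw [← map_zero (coeRingHom (u : Filter (Finset F))), ← map_zero (algebraMap A F)]
    congr 1; ext S; rw [halg, map_zero]; rfl
  · dsimp only
    rw [← map_add, coeRingHom_eq_iff]
    filter_upwards [hmem x, hmem y] with S hx hy
    simp only [r, Pi.add_apply, dif_pos hx, dif_pos hy, dif_pos (add_mem hx hy), ← map_add]
    rfl
  · ext a
    exact congrArg (coeRingHom (u : Filter (Finset F))) (funext (halg a))

end Filter.Germ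

open IntermediateField in
/-- A finitely generated separable extension embeds into a separably closed extension of infinite
transcendence degree. -/
lemma nonempty_algHom_of_isTranscendenceBasis {A F L : Type*} [Field A] [Field F] [Field L]
    [Algebra A F] [Algebra A L] [IsSepClosed L] {x : ℕ → L} (hx : AlgebraicIndependent A x)
    (s : Finset F) (hs : AlgebraicIndependent A ((↑) : s → F))
    [Algebra.IsSeparable (adjoin A (s : Set F)) F] : Nonempty (F →ₐ[A] L) := by
  have hinj : Function.Injective (fun i : s ↦ (s.equivFin i : ℕ)) :=
    Fin.val_injective.comp s.equivFin.injective
  have hx' := hx.comp _ hinj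
  have e : adjoin A (s : Set F) →ₐ[A] L := (val _).comp
    (hx'.aevalEquivField.toAlgHom.comp
    (hs.aevalEquivField.symm.toAlgHom.comp (equivOfEq (by simp)).toAlgHom))
  algebraize [e.toRingHom]
  have : IsScalarTower A (adjoin A (s : Set F)) L := .of_algebraMap_eq fun a ↦ (e.commutes a).symm
  exact ⟨(IsSepClosed.lift : F →ₐ[adjoin A (s : Set F)] L).restrictScalars A⟩

lemma IsFrobeniusBasis.linearIndepOn_pow {p : ℕ} {ι A F : Type*} [Fintype ι] [Field A] [Field F]
    [Algebra A F] [ExpChar F p] {v : ι → A} (hv : IsFrobeniusBasis p v)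
    (hv' : ∀ y : ι → F, ∑ i, y i ^ p * algebraMap A F (v i) = 0 → y = 0) (s : Finset F)
    (hs : LinearIndepOn A id (s : Set F)) : LinearIndepOn A (· ^ p) (s : Set F) := by
  rw [linearIndepOn_finset_iff] at hs ⊢
  intro a ha
  choose c hc hc' using fun x ↦ hv (a x)
  have h0 := hv' (fun i ↦ ∑ x ∈ s, c x i • x) ?_
  · have h1 (i) := hs (fun x ↦ c x i) (congrFun h0 i)
    intro x hx
    rw [← hc x]
    have hp := expChar_pos F p
    exact Finset.sum_eq_zero fun i _ ↦ by rw [h1 i x hx, zero_pow hp.ne', zero_mul]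
  · rw [← ha]
    simp_rw [sum_pow_char p, Finset.sum_mul]
    rw [Finset.sum_comm]
    refine Finset.sum_congr rfl fun x _ ↦ ?_
    conv_rhs => rw [← hc x, Finset.sum_smul]
    refine Finset.sum_congr rfl fun i _ ↦ ?_
    simp only [Algebra.smul_def, map_mul, map_pow]
    ring

/-- The monomial in the family `b` with exponents `ν`, all of which are less than `p`. -/
def truncatedMonomial {R : Type*} [CommMonoid R] {e p : ℕ} (b : Fin e → R)
    (ν : Fin e → Fin p) : R :=
  ∏ i, b i ^ (ν i : ℕ)

lemma map_truncatedMonomial {R S F : Type*} [CommMonoid R] [CommMonoid S] [FunLike F R S]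
    [MonoidHomClass F R S] (f : F) {e p : ℕ} (b : Fin e → R) (ν : Fin e → Fin p) :
    f (truncatedMonomial b ν) = truncatedMonomial (f ∘ b) ν := by
  simp [truncatedMonomial]

open IntermediateField in
lemma exists_linearIndependent_truncatedMonomial (p : ℕ) [Fact p.Prime] {K : Type*} [Field K]
    [CharP K p] (e : ℕ) (k : Subfield K) (hk : ∀ x : K, x ^ p ∈ k)
    (hr : Module.finrank k K = p ^ e) :
    ∃ b : Fin e → K, LinearIndependent k (truncatedMonomial b : (Fin e → Fin p) → K) := by
  have hp : p.Prime := Fact.out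
  induction e generalizing k with
  | zero => exact ⟨Fin.elim0, linearIndependent_unique_iff.2 (by simp [truncatedMonomial])⟩
  | succ e ih =>
    have hfin : FiniteDimensional k K :=
      Module.finite_of_finrank_pos (by rw [hr]; exact pow_pos hp.pos _)
    obtain ⟨b, hb⟩ : ∃ b : K, b ∉ k := by
      by_contra! h
      have : (⊥ : Subalgebra k K) = ⊤ := by
        rw [eq_top_iff]
        exact fun x _ ↦ ⟨⟨x, h x⟩, rfl⟩
      have := Subalgebra.bot_eq_top_iff_finrank_eq_one.1 this
      rw [hr] at this
      exact (Nat.one_lt_pow (Nat.succ_ne_zero e) hp.one_lt).ne' this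
    have hbint : IsIntegral k b := Algebra.IsIntegral.isIntegral b
    have hmin : Polynomial.X ^ p - Polynomial.C (⟨b ^ p, hk b⟩ : k) = minpoly k b := by
      refine minpoly.eq_of_irreducible_of_monic (X_pow_sub_C_irreducible_of_prime hp fun c hc ↦ ?_)
        ?_ (Polynomial.monic_X_pow_sub_C _ hp.ne_zero)
      · have h1 : (c : K) ^ p = b ^ p := congrArg Subtype.val hc
        have h2 : (c : K) = b := frobenius_inj K p h1
        exact hb (h2 ▸ c.2)
      · simp only [map_sub, map_pow, Polynomial.aeval_X, Polynomial.aeval_C]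
        exact sub_self _
    have hdeg : (minpoly k b).natDegree = p := by
      rw [← hmin, Polynomial.natDegree_X_pow_sub_C]
    have hkb : Module.finrank k k⟮b⟯ = p := by rw [adjoin.finrank hbint, hdeg]
    have hr' : Module.finrank k⟮b⟯ K = p ^ e := by
      have := Module.finrank_mul_finrank k k⟮b⟯ K
      rw [hkb, hr, pow_succ'] at this
      exact Nat.eq_of_mul_eq_mul_left hp.pos this
    obtain ⟨c, hc⟩ := ih k⟮b⟯.toSubfield (fun x ↦ k⟮b⟯.algebraMap_mem ⟨_, hk x⟩) hr'
    refine ⟨Fin.cons b c, ?_⟩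
    have hpow : LinearIndependent k (fun i : Fin p ↦ AdjoinSimple.gen k b ^ (i : ℕ)) := by
      have := (adjoin.powerBasis hbint).basis.linearIndependent
      have hd : (adjoin.powerBasis hbint).dim = p := hdeg
      have h2 := this.comp (finCongr hd.symm) (finCongr hd.symm).injective
      convert! h2 using 1
      ext i
      simp [adjoin.powerBasis_gen]
    have hprod := linearIndependent_smul (S := k⟮b⟯) hpow hc
    have := hprod.comp _ (Fin.consEquiv (fun _ : Fin (e + 1) ↦ Fin p)).symm.injective
    convert! this using 1
    ext ν
    simp only [truncatedMonomial, Fin.prod_univ_succ, Function.comp]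
    rfl

lemma exists_isFrobeniusBasis_truncatedMonomial (p : ℕ) [Fact p.Prime] (e : ℕ) {K : Type*} [Field K]
    [CharP K p] (h : Module.finrank (frobenius K p).fieldRange K = p ^ e) :
    ∃ b : Fin e → K, IsFrobeniusBasis p (truncatedMonomial b : (Fin e → Fin p) → K) := by
  have hp : p.Prime := Fact.out
  obtain ⟨b, hb⟩ := exists_linearIndependent_truncatedMonomial p e (frobenius K p).fieldRange
    (fun x ↦ (frobenius K p).mem_fieldRange.2 ⟨x, rfl⟩) h
  refine ⟨b, fun x ↦ ?_⟩
  let B := basisOfLinearIndependentOfCardEqFinrank hb (by simp [h])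
  have hB (ν) : B ν = truncatedMonomial b ν := by simp [B]
  choose y hy using fun c : (frobenius K p).fieldRange ↦ c.2
  refine ⟨fun ν ↦ y (B.repr x ν), ?_, fun z hz ↦ ?_⟩
  · refine Eq.trans ?_ (B.sum_repr x)
    refine Finset.sum_congr rfl fun ν _ ↦ ?_
    rw [hB, Subfield.smul_def, ← hy, smul_eq_mul, frobenius_def]
  · ext ν
    have : B.repr x ν = ⟨frobenius K p (z ν), z ν, rfl⟩ := by
      rw [← hz]
      have : ∑ ν, z ν ^ p * truncatedMonomial b ν =
          ∑ ν, (⟨frobenius K p (z ν), z ν, rfl⟩ : (frobenius K p).fieldRange) • B ν :=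
        Finset.sum_congr rfl fun ν _ ↦ by rw [hB]; rfl
      rw [this, B.repr_sum_self]
    rw [this]
    exact frobenius_inj K p (hy ⟨frobenius K p (z ν), z ν, rfl⟩).symm

open MvPolynomial in
/-- Every polynomial over `ZMod p` is a combination of the truncated monomials whose coefficients are
`p`-th powers of polynomials, with control of the degrees. -/
lemma exists_sum_pow_mul_truncatedMonomial (p : ℕ) [Fact p.Prime] {e : ℕ}
    (Q : MvPolynomial (Fin e) (ZMod p)) :
    ∃ g : (Fin e → Fin p) → MvPolynomial (Fin e) (ZMod p),
      ∑ ν, g ν ^ p * truncatedMonomial X ν = Q ∧ ∀ ν, p * (g ν).totalDegree ≤ Q.totalDegree := by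
  classical
  have hp : p.Prime := Fact.out
  conv => enter [1, g, 1]; rw [Q.as_sum]
  refine Finset.sum_induction _ (fun R : MvPolynomial (Fin e) (ZMod p) ↦
    ∃ g : (Fin e → Fin p) → MvPolynomial (Fin e) (ZMod p),
      ∑ ν, g ν ^ p * truncatedMonomial X ν = R ∧ ∀ ν, p * (g ν).totalDegree ≤ Q.totalDegree) ?_ ?_ ?_
  · rintro _ _ ⟨g, rfl, hg⟩ ⟨h, rfl, hh⟩
    refine ⟨g + h, ?_, fun ν ↦ ?_⟩
    · simp only [Pi.add_apply, add_pow_char, add_mul, Finset.sum_add_distrib]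
    · refine (Nat.mul_le_mul_left p (totalDegree_add _ _)).trans ?_
      rcases max_choice (g ν).totalDegree (h ν).totalDegree with h | h <;> simp only [h, hg, hh]
  · exact ⟨0, by simp [hp.ne_zero], by simp⟩
  · intro m hm
    let m' : Fin e →₀ ℕ := m.mapRange (· / p) (by simp)
    let μ : Fin e → Fin p := fun i ↦ ⟨m i % p, Nat.mod_lt _ hp.pos⟩
    refine ⟨fun ν ↦ if ν = μ then monomial m' (coeff m Q) else 0, ?_, fun ν ↦ ?_⟩
    · rw [Finset.sum_eq_single μ (fun ν _ h ↦ by simp [h, hp.ne_zero]) (by simp)]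
      simp only [↓reduceIte]
      rw [monomial_pow, ZMod.pow_card]
      have : (truncatedMonomial X μ : MvPolynomial (Fin e) (ZMod p)) =
          monomial (Finsupp.equivFunOnFinite.symm fun i ↦ m i % p) 1 := by
        rw [monomial_eq, Finsupp.prod_fintype _ _ (by simp)]
        simp [truncatedMonomial, μ]
      have hm' : p • m' + Finsupp.equivFunOnFinite.symm (fun i ↦ m i % p) = m := by
        ext i
        simp [m', Nat.div_add_mod]
      rw [this, monomial_mul, mul_one, hm']
    · dsimp only
      split_ifs
      · refine le_trans ?_ (le_totalDegree hm)
        refine (Nat.mul_le_mul_left p (totalDegree_monomial_le _ _)).trans ?_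
        rw [Finsupp.sum_fintype _ _ (by simp), Finsupp.sum_fintype _ _ (by simp), Finset.mul_sum]
        exact Finset.sum_le_sum fun i _ ↦ Nat.mul_div_le _ _
      · simp

lemma IsFrobeniusBasis.algebraicIndependent {p : ℕ} [Fact p.Prime] {e : ℕ} {K : Type*} [Field K]
    [Algebra (ZMod p) K] {b : Fin e → K}
    (hb : IsFrobeniusBasis p (truncatedMonomial b : (Fin e → Fin p) → K)) :
    AlgebraicIndependent (ZMod p) b := by
  have hp : p.Prime := Fact.out
  rw [algebraicIndependent_iff]
  intro Q
  induction hn : Q.totalDegree using Nat.strong_induction_on generalizing Q with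
  | _ n ih =>
  intro hQ
  obtain ⟨g, hgQ, hg⟩ := exists_sum_pow_mul_truncatedMonomial p Q
  have hz (ν) : MvPolynomial.aeval b (g ν) = 0 := by
    refine congrFun ((hb 0).unique (y₂ := fun _ ↦ 0) (y₁ := fun ν ↦ MvPolynomial.aeval b (g ν)) ?_
      (by simp [hp.ne_zero])) ν
    rw [← hQ, ← hgQ, map_sum]
    refine Finset.sum_congr rfl fun ν _ ↦ ?_
    rw [map_mul, map_pow, map_truncatedMonomial]
    congr 2
    ext i
    simp
  rcases Nat.eq_zero_or_pos n with rfl | hpos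
  · rw [MvPolynomial.totalDegree_eq_zero_iff_eq_C] at hn
    rw [hn, MvPolynomial.aeval_C, map_eq_zero] at hQ
    rw [hn, hQ, map_zero]
  · rw [← hgQ]
    refine Finset.sum_eq_zero fun ν _ ↦ ?_
    rw [ih (g ν).totalDegree ?_ _ rfl (hz ν), zero_pow hp.ne_zero, zero_mul]
    have := hg ν
    have := hp.two_le
    nlinarith

open MvPolynomial in
lemma isFrobeniusBasis_fractionRing (p : ℕ) [Fact p.Prime] (e : ℕ) {K : Type*} [Field K]
    (f : FractionRing (MvPolynomial (Fin e) (ZMod p)) →+* K)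
    (h : IsFrobeniusBasis p (f ∘ truncatedMonomial (p := p) fun i ↦
      algebraMap (MvPolynomial (Fin e) (ZMod p)) _ (X i))) :
    IsFrobeniusBasis p (truncatedMonomial (p := p) fun i ↦ algebraMap (MvPolynomial (Fin e) (ZMod p))
      (FractionRing (MvPolynomial (Fin e) (ZMod p))) (X i)) := by
  have hp : p.Prime := Fact.out
  intro x
  refine existsUnique_of_exists_of_unique ?_ fun y z hy hz ↦ ?_
  · obtain ⟨a, d, hd, rfl⟩ := IsFractionRing.div_surjective (A := MvPolynomial (Fin e) (ZMod p)) x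
    obtain ⟨g, hg, -⟩ := exists_sum_pow_mul_truncatedMonomial p (a * d ^ (p - 1))
    have hd0 : algebraMap _ (FractionRing (MvPolynomial (Fin e) (ZMod p))) d ≠ 0 := by
      simpa using nonZeroDivisors.ne_zero hd
    refine ⟨fun ν ↦ algebraMap _ _ (g ν) / algebraMap _ _ d, ?_⟩
    rw [eq_div_iff hd0, ← mul_left_inj' (pow_ne_zero (p - 1) hd0), mul_assoc,
      mul_pow_sub_one hp.ne_zero, ← map_pow, ← map_pow, ← map_mul, ← hg, map_sum, Finset.sum_mul]
    refine Finset.sum_congr rfl fun ν _ ↦ ?_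
    rw [map_mul, map_pow, map_pow, map_truncatedMonomial, div_pow, div_mul_eq_mul_div,
      div_mul_cancel₀ _ (pow_ne_zero _ hd0)]
    rfl
  · have := (h (f x)).unique (y₁ := f ∘ y) (y₂ := f ∘ z) ?_ ?_
    · exact funext fun ν ↦ f.injective (congrFun this ν)
    · simp [← hy]
    · simp [← hz]

/-- If `K₁` and `K₂` extend `A`, preserving a Frobenius basis, and `K₂` is separably closed, then `K₁`
embeds over `A` into some elementary extension of `K₂`. -/
lemma exists_realize_iff_extension {A : Type*} {K₁ K₂ : Type w} [Field A] [Field K₁] [Field K₂]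
    [IsSepClosed K₂] (p : ℕ) [Fact p.Prime] [CharP A p] {ι : Type*} [Fintype ι] {v : ι → A}
    (hv : IsFrobeniusBasis p v) (f₁ : A →+* K₁) (f₂ : A →+* K₂)
    (h₁ : IsFrobeniusBasis p (f₁ ∘ v)) (h₂ : IsFrobeniusBasis p (f₂ ∘ v)) :
    ∃ (L : Type w) (_ : Field L) (_ : IsSepClosed L) (j : K₂ →+* L) (g : K₁ →+* L),
      g.comp f₁ = j.comp f₂ ∧ IsFrobeniusBasis p (j ∘ f₂ ∘ v) ∧
      ∀ {n : ℕ} (φ : Language.ring.BoundedFormula Empty n) (x : Fin n → K₂),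
        φ.Realize default (j ∘ x) ↔ φ.Realize default x := by
  have hp : p.Prime := Fact.out
  have : CharP K₁ p := charP_of_injective_ringHom f₁.injective p
  have : CharP K₂ p := charP_of_injective_ringHom f₂.injective p
  have : Infinite K₂ := by
    by_contra h
    rw [not_infinite_iff_finite] at h
    exact not_finite K₂
  obtain ⟨u, x, hx⟩ := Filter.Germ.exists_forall_ne_zero_eval₂_ne_zero K₂ ℕ
  let L₁ : Type w := Filter.Germ (u : Filter (Finset (MvPolynomial ℕ K₂))) K₂
  let d₁ : K₂ →+* L₁ := Filter.Germ.diagonal u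
  let : Algebra A K₁ := f₁.toAlgebra
  let : Algebra A L₁ := (d₁.comp f₂).toAlgebra
  have hind : AlgebraicIndependent A x := by
    rw [algebraicIndependent_iff]
    intro P hP
    by_contra h0
    refine hx (P.map f₂) ?_ ?_
    · rwa [Ne, map_eq_zero_iff _ (MvPolynomial.map_injective _ f₂.injective)]
    · rw [MvPolynomial.eval₂_map]; exact hP
  obtain ⟨u₂, g, hg⟩ := Filter.Germ.exists_ringHom_of_forall_adjoin (K := L₁) A K₁ fun S ↦ by
    let F := IntermediateField.adjoin A (S : Set K₁)
    have : Algebra.EssFiniteType A F :=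
      IntermediateField.essFiniteType_iff.2 (IntermediateField.fg_adjoin_finset S)
    have : CharP F p := charP_of_injective_algebraMap (algebraMap A F).injective p
    obtain ⟨s, hs, hs'⟩ :=
      exists_isTranscendenceBasis_and_isSeparable_of_linearIndepOn_pow_of_essFiniteType
        (k := A) (K := F) p hp (hv.linearIndepOn_pow fun y hy ↦ by
          funext i
          have := congrFun ((h₁ 0).unique (y₁ := fun i ↦ (y i : K₁)) (y₂ := 0)
            (by simpa [RingHom.algebraMap_toAlgebra] using congrArg (algebraMap F K₁) hy)
            (by simp [hp.ne_zero])) i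
          exact Subtype.ext this)
    exact nonempty_algHom_of_isTranscendenceBasis hind s hs.1
  refine ⟨_, inferInstance, inferInstance, (Filter.Germ.diagonal u₂).comp d₁, g, hg, ?_, ?_⟩
  · exact Filter.Germ.isFrobeniusBasis_diagonal u₂ (Filter.Germ.isFrobeniusBasis_diagonal u h₂)
  · intro n φ x
    exact (Filter.Germ.realize_diagonal u₂ φ (d₁ ∘ x)).trans (Filter.Germ.realize_diagonal u φ x)

/-- Formulas with parameters in `A` have the same truth value in any two separably closed extensions
of `A` preserving a Frobenius basis. -/
theorem realize_iff_of_isFrobeniusBasis (p : ℕ) [Fact p.Prime] {ι : Type*} [Fintype ι]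
    {n : ℕ} (φ : Language.ring.BoundedFormula Empty n)
    {A K₁ K₂ : Type w} [Field A] [Field K₁] [Field K₂] [CharP A p]
    [IsSepClosed K₁] [IsSepClosed K₂] {v : ι → A}
    (hv : IsFrobeniusBasis p v) (f₁ : A →+* K₁) (f₂ : A →+* K₂)
    (h₁ : IsFrobeniusBasis p (f₁ ∘ v)) (h₂ : IsFrobeniusBasis p (f₂ ∘ v)) (x : Fin n → A) :
    φ.Realize default (f₁ ∘ x) ↔ φ.Realize default (f₂ ∘ x) := by
  induction φ generalizing A K₁ K₂ with
  | falsum => rfl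
  | @equal n t₁ t₂ =>
    have key {K : Type w} [Field K] (f : A →+* K) (t : Language.ring.Term (Empty ⊕ Fin n)) :
        t.realize (Sum.elim default (f ∘ x)) = f (t.realize (Sum.elim default x)) := by
      induction t with
      | var i => rcases i with i | i; exacts [i.elim, rfl]
      | func F ts ih =>
        simp only [Term.realize, ih]
        cases F <;> simp [Ring.CompatibleRing.funMap_add]
    simp only [BoundedFormula.Realize, key, f₁.injective.eq_iff, f₂.injective.eq_iff]
  | rel R => exact R.elim
  | imp _ _ ih₁ ih₂ =>
    simp only [BoundedFormula.realize_imp, ih₁ hv f₁ f₂ h₁ h₂, ih₂ hv f₁ f₂ h₁ h₂]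
  | @all n φ ih =>
    have key {K₁ K₂ : Type w} [Field K₁] [Field K₂] [IsSepClosed K₁] [IsSepClosed K₂]
        (f₁ : A →+* K₁) (f₂ : A →+* K₂)
        (h₁ : IsFrobeniusBasis p (f₁ ∘ v)) (h₂ : IsFrobeniusBasis p (f₂ ∘ v))
        (h : φ.all.Realize default (f₂ ∘ x)) : φ.all.Realize default (f₁ ∘ x) := by
      obtain ⟨L, _, _, j, g, hgj, hL, hj⟩ := exists_realize_iff_extension p hv f₁ f₂ h₁ h₂
      have := charP_of_injective_ringHom f₁.injective p
      have hgj' (a : A) : g (f₁ a) = j (f₂ a) := DFunLike.congr_fun hgj a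
      intro a
      refine (ih h₁ (RingHom.id K₁) g h₁ ?_ (Fin.snoc (f₁ ∘ x) a)).2 ?_
      · convert hL using 1
        exact funext fun i ↦ hgj' (v i)
      · rw [← hj] at h
        rw [Fin.comp_snoc]
        convert h (g a) using 2
        exact funext fun i ↦ hgj' (x i)
    exact ⟨key f₂ f₁ h₂ h₁, key f₁ f₂ h₁ h₂⟩

lemma exists_ringHom_isFrobeniusBasis (p : ℕ) [Fact p.Prime] (e : ℕ) (K : Type*) [Field K]
    [CharP K p] (h : Module.finrank (frobenius K p).fieldRange K = p ^ e) :
    ∃ f : FractionRing (MvPolynomial (Fin e) (ZMod p)) →+* K,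
      IsFrobeniusBasis p (f ∘ truncatedMonomial (p := p) (fun i ↦
        algebraMap (MvPolynomial (Fin e) (ZMod p)) _ (MvPolynomial.X i))) := by
  obtain ⟨b, hb⟩ := exists_isFrobeniusBasis_truncatedMonomial p e h
  let := ZMod.algebra K p
  have hind := hb.algebraicIndependent
  refine ⟨((IntermediateField.val _).comp hind.aevalEquivField.toAlgHom).toRingHom, ?_⟩
  convert hb using 1
  funext ν
  refine (map_truncatedMonomial _ _ ν).trans ?_
  congr 1
  funext i
  simp

/-- Separably closed extensions of a field `A` in which some Frobenius basis of `A` remains a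
Frobenius basis are elementarily equivalent. -/
theorem elementarilyEquivalent_of_isFrobeniusBasis (p : ℕ) [Fact p.Prime] {ι : Type*} [Fintype ι]
    {A : Type*} {K₁ K₂ : Type w} [Field A] [Field K₁] [Field K₂] [CharP A p]
    [IsSepClosed K₁] [IsSepClosed K₂] {v : ι → A}
    (hv : IsFrobeniusBasis p v) (f₁ : A →+* K₁) (f₂ : A →+* K₂)
    (h₁ : IsFrobeniusBasis p (f₁ ∘ v)) (h₂ : IsFrobeniusBasis p (f₂ ∘ v)) :
    K₁ ≅[Language.ring] K₂ := by
  have := charP_of_injective_ringHom f₁.injective p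
  obtain ⟨L, _, _, j, g, hgj, hL, hj⟩ := exists_realize_iff_extension p hv f₁ f₂ h₁ h₂
  rw [elementarilyEquivalent_iff]
  intro φ
  have key := realize_iff_of_isFrobeniusBasis p φ h₁ (RingHom.id K₁) g h₁
    (by convert hL using 1
        exact funext fun i ↦ DFunLike.congr_fun hgj _) default
  have hj := hj φ default
  rw [Subsingleton.elim (j ∘ default) default] at hj
  rw [Subsingleton.elim (g ∘ default) default,
    Subsingleton.elim (RingHom.id K₁ ∘ default) default] at key
  exact key.trans hj

lemma IsFrobeniusBasis.map_ringEquiv {p : ℕ} {ι K L : Type*} [Fintype ι] [Field K] [Field L]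
    {v : ι → K} (hv : IsFrobeniusBasis p v) (f : K ≃+* L) : IsFrobeniusBasis p (f ∘ v) := by
  intro x
  obtain ⟨y, hy, hy'⟩ := hv (f.symm x)
  refine ⟨f ∘ y, ?_, fun z hz ↦ ?_⟩
  · simpa using congrArg f hy
  · rw [← hy' (f.symm ∘ z) (by simpa using congrArg f.symm hz)]
    ext i
    simp

lemma IsSepClosed.of_ringEquiv_s12 {K L : Type*} [Field K] [Field L] [IsSepClosed K] (f : K ≃+* L) :
    IsSepClosed L where
  splits_of_separable q hq := by
    have := (IsSepClosed.splits_of_separable (q.map f.symm.toRingHom) hq.map).map f.toRingHom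
    rwa [Polynomial.map_map, RingEquiv.toRingHom_comp_symm_toRingHom, Polynomial.map_id] at this

/-- Ershov's completeness theorem for `SCF_p^e`: any two separably closed fields of
characteristic `p` with the same finite degree of imperfection `e` (i.e. with
`[Kᵢ : Kᵢ^p] = p ^ e`) are elementarily equivalent in the language of rings. -/
theorem scf_finite_imperfection_elementarilyEquivalent
    (p : ℕ) [Fact p.Prime] (e : ℕ)
    (K₁ : Type*) (K₂ : Type*) [Field K₁] [Field K₂] [CharP K₁ p] [CharP K₂ p]
    [IsSepClosed K₁] [IsSepClosed K₂]
    (h₁ : Module.finrank ((frobenius K₁ p).fieldRange) K₁ = p ^ e)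
    (h₂ : Module.finrank ((frobenius K₂ p).fieldRange) K₂ = p ^ e) :
    K₁ ≅[Language.ring] K₂ := by
  obtain ⟨f₁, h₁⟩ := exists_ringHom_isFrobeniusBasis p e K₁ h₁
  obtain ⟨f₂, h₂⟩ := exists_ringHom_isFrobeniusBasis p e K₂ h₂
  have : CharP (FractionRing (MvPolynomial (Fin e) (ZMod p))) p :=
    (RingHom.charP_iff f₁ f₁.injective p).2 inferInstance
  let E₁ : K₁ ≃+* ULift.{max u_1 u_2} K₁ := ULift.ringEquiv.symm
  let E₂ : K₂ ≃+* ULift.{max u_1 u_2} K₂ := ULift.ringEquiv.symm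
  have := IsSepClosed.of_ringEquiv_s12 E₁
  have := IsSepClosed.of_ringEquiv_s12 E₂
  exact ((StrongHomClass.elementarilyEquivalent (Ring.languageEquivEquivRingEquiv.symm E₁)).trans
    (elementarilyEquivalent_of_isFrobeniusBasis p (isFrobeniusBasis_fractionRing p e f₁ h₁)
      (E₁.toRingHom.comp f₁) (E₂.toRingHom.comp f₂) (h₁.map_ringEquiv E₁)
      (h₂.map_ringEquiv E₂))).trans
    (StrongHomClass.elementarilyEquivalent (Ring.languageEquivEquivRingEquiv.symm E₂)).symm
end
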